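/- Let K ⊂ ℝⁿ×ℝⁿ be compact with interior K°. For each h ∈ (0,h₀] let X(h) ⊂ ℝⁿ be a finite set with N(h) := #X(h). Assume there is a constant C such that for every family (f_h) which is semiclassically band limited (in some compact set) and whose semiclassical wave front set is contained in K, one has the stability estimate ‖f_h‖²_{L²} ≤ C Σ_{x∈X(h)} |f_h(x)|² + O(h^∞) (the O(h^∞) constants may depend on the family). Then liminf_{h→0} (2πh)ⁿ N(h) ≥ Vol(K°), where Vol is the 2n-dimensional Lebesgue measure; equivalently N(h) ≥ (2πh)^{−n} Vol(K°)(1 − o(1)) as h → 0. -/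

import Mathlib

open MeasureTheory Complex

/-- The Euclidean pairing `x·ξ = ∑ xʲξⱼ` on `ℝⁿ`. -/
noncomputable def dotp {n : ℕ} (x ξ : Fin n → ℝ) : ℝ := ∑ j, x j * ξ j

/-- The semiclassical Fourier transform `F_h g(ξ) = ∫ e^{−i x·ξ/h} g(x) dx`. -/
noncomputable def scFT {n : ℕ} (h : ℝ) (g : (Fin n → ℝ) → ℂ) (ξ : Fin n → ℝ) : ℂ :=
  ∫ x : Fin n → ℝ, Complex.exp (((-(dotp x ξ) / h : ℝ) : ℂ) * Complex.I) * g x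

/-- The squared semiclassical Sobolev norm
`‖f‖²_{H_h^s} = (2πh)^{−n} ∫ (1+|ξ|²)^s |F_h f(ξ)|² dξ`. -/
noncomputable def hSobSq (n : ℕ) (h s : ℝ) (f : (Fin n → ℝ) → ℂ) : ℝ :=
  (2 * Real.pi * h) ^ (-(n : ℤ)) *
    ∫ ξ : Fin n → ℝ, (1 + ∑ j, ξ j ^ 2) ^ s * ‖scFT h f ξ‖ ^ 2

/-- `(f_h)_{h∈(0,h₀]}` is semiclassically band limited in the compact set `𝓑 ⊂ ℝⁿ`. -/
def SCBandLimited (n : ℕ) (h₀ : ℝ) (f : ℝ → (Fin n → ℝ) → ℂ)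
    (𝓑 : Set (Fin n → ℝ)) : Prop :=
  IsCompact 𝓑 ∧
  (∀ h ∈ Set.Ioc (0 : ℝ) h₀, ContDiff ℝ (⊤ : ℕ∞) (f h) ∧ HasCompactSupport (f h)) ∧
  (∃ K : Set (Fin n → ℝ), IsCompact K ∧
    ∀ h ∈ Set.Ioc (0 : ℝ) h₀, Function.support (f h) ⊆ K) ∧
  (∃ s N C : ℝ, ∀ h ∈ Set.Ioc (0 : ℝ) h₀, hSobSq n h s (f h) ≤ C * h ^ (-N)) ∧
  (∀ U : Set (Fin n → ℝ), IsOpen U → 𝓑 ⊆ U → ∀ N : ℕ, ∃ C : ℝ,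
    ∀ h ∈ Set.Ioc (0 : ℝ) h₀, ∀ ξ : Fin n → ℝ, ξ ∉ U →
      ‖scFT h (f h) ξ‖ ≤ C * h ^ N * (1 + Real.sqrt (∑ j, ξ j ^ 2)) ^ (-(N : ℝ)))

/-- The finite point `(x₀,ξ₀)` is not in the semiclassical wave front set of `(f_h)`. -/
def NotInSCWF (n : ℕ) (h₀ : ℝ) (f : ℝ → (Fin n → ℝ) → ℂ) (x₀ ξ₀ : Fin n → ℝ) : Prop :=
  ∃ φ : (Fin n → ℝ) → ℂ, ContDiff ℝ (⊤ : ℕ∞) φ ∧ HasCompactSupport φ ∧ φ x₀ ≠ 0 ∧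
    ∃ V ∈ nhds ξ₀, ∀ N : ℕ, ∃ C : ℝ, ∀ h ∈ Set.Ioc (0 : ℝ) h₀, ∀ ξ ∈ V,
      ‖scFT h (fun x => φ x * f h x) ξ‖ ≤ C * h ^ N

/-- The pairing `dotp` as a continuous bilinear map. -/
noncomputable def dotpL (n : ℕ) : (Fin n → ℝ) →L[ℝ] (Fin n → ℝ) →L[ℝ] ℝ :=
  LinearMap.toContinuousBilinearMap (LinearMap.mk₂ ℝ (dotp (n := n))
    (fun x y ξ => by simp [dotp, add_mul, Finset.sum_add_distrib])
    (fun c x ξ => by simp [dotp, Finset.mul_sum, mul_assoc])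
    (fun x ξ η => by simp [dotp, mul_add, Finset.sum_add_distrib])
    (fun c x ξ => by simp [dotp, Finset.mul_sum, mul_left_comm]))

lemma dotpL_apply {n : ℕ} (x ξ : Fin n → ℝ) : dotpL n x ξ = dotp x ξ := rfl

lemma scFT_eq_fourierIntegral {n : ℕ} {h : ℝ} (hh : 0 < h) (g : (Fin n → ℝ) → ℂ)
    (ξ : Fin n → ℝ) :
    scFT h g ξ = VectorFourier.fourierIntegral Real.fourierChar volume
      (dotpL n).toLinearMap₁₂ g ((2 * Real.pi * h)⁻¹ • ξ) := by
  unfold scFT VectorFourier.fourierIntegral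
  refine integral_congr_ae (Filter.Eventually.of_forall fun x => ?_)
  have : (dotpL n).toLinearMap₁₂ x ((2 * Real.pi * h)⁻¹ • ξ)
      = (2 * Real.pi * h)⁻¹ * dotp x ξ := by
    change dotpL n x _ = _
    rw [map_smul, dotpL_apply, smul_eq_mul]
  simp only [Circle.smul_def, Real.fourierChar_apply, smul_eq_mul]
  rw [this]
  congr 4
  have := Real.pi_pos
  field_simp

lemma pow_mul_norm_scFT_le {n : ℕ} {g : (Fin n → ℝ) → ℂ} (hg : ContDiff ℝ (⊤ : ℕ∞) g)
    (hgc : HasCompactSupport g) (N : ℕ) :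
    ∃ C : ℝ, 0 ≤ C ∧ ∀ h : ℝ, 0 < h → ∀ ξ : Fin n → ℝ,
      ‖ξ‖ ^ N * ‖scFT h g ξ‖ ≤ C * h ^ N := by
  have hint : ∀ k m : ℕ, (k : ℕ∞) ≤ (⊤ : ℕ∞) → (m : ℕ∞) ≤ (⊤ : ℕ∞) →
      Integrable (fun v : Fin n → ℝ => ‖v‖ ^ k * ‖iteratedFDeriv ℝ m g v‖) volume := by
    intro k m _ _
    refine Continuous.integrable_of_hasCompactSupport ?_ ?_
    · exact (continuous_norm.pow k).mul
        (hg.continuous_iteratedFDeriv (mod_cast le_top)).norm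
    · exact (hgc.iteratedFDeriv m).norm.mul_left
  set A : ℕ → ℝ := fun N => (2 * (0 : ℕ) + 2) ^ N *
      ∑ p ∈ Finset.range (0 + 1) ×ˢ Finset.range (N + 1),
          ∫ v, ‖v‖ ^ p.1 * ‖iteratedFDeriv ℝ p.2 g v‖ with hA
  have hA0 : 0 ≤ A N := by
    simp only [hA]
    positivity
  have key : ∀ (w : Fin n → ℝ) (i : Fin n), |w i| ^ N *
      ‖VectorFourier.fourierIntegral Real.fourierChar volume
      (dotpL n).toLinearMap₁₂ g w‖ ≤ A N := by
    intro w i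
    have := VectorFourier.pow_mul_norm_iteratedFDeriv_fourierIntegral_le (dotpL n) (μ := volume)
      hg hint (k := 0) (n := N) le_top le_top (Pi.single i 1) w
    simpa [dotpL_apply, dotp, Pi.single_apply, Pi.norm_single, hA] using this
  have hpi := Real.pi_pos
  rcases Nat.eq_zero_or_pos N with rfl | hN
  · refine ⟨∫ x, ‖g x‖, by positivity, fun h hh ξ => ?_⟩
    rw [scFT_eq_fourierIntegral hh]
    simpa using VectorFourier.norm_fourierIntegral_le_integral_norm _ _ _ _ _
  refine ⟨A N * (2 * Real.pi) ^ N, by positivity, fun h hh ξ => ?_⟩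
  rcases isEmpty_or_nonempty (Fin n) with hn | hn
  · have : ξ = 0 := Subsingleton.elim _ _
    rw [this, norm_zero, zero_pow hN.ne', zero_mul]
    positivity
  obtain ⟨i, hi⟩ : ∃ i, ‖ξ‖ = |ξ i| := by
    obtain ⟨i, -, hi⟩ := Finset.exists_max_image Finset.univ (fun i => ‖ξ i‖) Finset.univ_nonempty
    refine ⟨i, le_antisymm ?_ (norm_le_pi_norm ξ i)⟩
    exact (pi_norm_le_iff_of_nonneg (abs_nonneg _)).2 fun j => hi j (Finset.mem_univ j)
  have h1 := key ((2 * Real.pi * h)⁻¹ • ξ) i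
  rw [← scFT_eq_fourierIntegral hh, Pi.smul_apply, smul_eq_mul, abs_mul, ← hi,
    abs_of_pos (by positivity), mul_pow, inv_pow, mul_assoc, inv_mul_le_iff₀ (by positivity)] at h1
  calc _ ≤ _ := h1
    _ = _ := by ring

lemma pow_mul_norm_scFT_le_of_finite {n : ℕ} {ι : Type*} {S : Set ι} (hS : S.Finite)
    {g : ι → (Fin n → ℝ) → ℂ} (hg : ∀ k, ContDiff ℝ (⊤ : ℕ∞) (g k))
    (hgc : ∀ k, HasCompactSupport (g k)) (N : ℕ) :
    ∃ C : ℝ, 0 ≤ C ∧ ∀ k ∈ S, ∀ h : ℝ, 0 < h → ∀ ξ : Fin n → ℝ,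
      ‖ξ‖ ^ N * ‖scFT h (g k) ξ‖ ≤ C * h ^ N := by
  choose C hC0 hC using fun k => pow_mul_norm_scFT_le (hg k) (hgc k) N
  refine ⟨∑ k ∈ hS.toFinset, C k, Finset.sum_nonneg fun k _ => hC0 k, fun k hk h hh ξ => ?_⟩
  refine (hC k h hh ξ).trans ?_
  gcongr
  exact Finset.single_le_sum (f := C) (fun k _ => hC0 k) (hS.mem_toFinset.2 hk)

/-- The function `g` modulated to the semiclassical frequency `η`. -/
noncomputable def modulate {n : ℕ} (h : ℝ) (g : (Fin n → ℝ) → ℂ) (η x : Fin n → ℝ) : ℂ :=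
  g x * Complex.exp (((dotp x η / h : ℝ) : ℂ) * Complex.I)

lemma contDiff_dotp_left {n : ℕ} (η : Fin n → ℝ) :
    ContDiff ℝ (⊤ : ℕ∞) (fun x : Fin n → ℝ => dotp x η) := by
  unfold dotp
  fun_prop

lemma contDiff_modulate {n : ℕ} (h : ℝ) {g : (Fin n → ℝ) → ℂ} (hg : ContDiff ℝ (⊤ : ℕ∞) g)
    (η : Fin n → ℝ) : ContDiff ℝ (⊤ : ℕ∞) (modulate h g η) := by
  unfold modulate
  refine hg.mul (ContDiff.cexp (ContDiff.mul ?_ contDiff_const))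
  exact Complex.ofRealCLM.contDiff.comp ((contDiff_dotp_left η).div_const h)

lemma HasCompactSupport.modulate {n : ℕ} (h : ℝ) {g : (Fin n → ℝ) → ℂ}
    (hg : HasCompactSupport g) (η : Fin n → ℝ) : HasCompactSupport (modulate h g η) :=
  hg.mul_right

lemma scFT_modulate {n : ℕ} (h : ℝ) (g : (Fin n → ℝ) → ℂ) (η ξ : Fin n → ℝ) :
    scFT h (modulate h g η) ξ = scFT h g (ξ - η) := by
  unfold scFT modulate
  refine integral_congr_ae (Filter.Eventually.of_forall fun x => ?_)
  have h1 : dotp x (ξ - η) = dotp x ξ - dotp x η := by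
    simp [← dotpL_apply]
  simp only [h1]
  rw [mul_comm (g x), ← mul_assoc, ← Complex.exp_add]
  congr 2
  push_cast
  ring

/-- A finite superposition of wave packets. -/
noncomputable def packetSum {n : ℕ} {α : Type*} (h : ℝ) (J : Finset α) (c : α → ℂ)
    (g : α → (Fin n → ℝ) → ℂ) (η : α → Fin n → ℝ) (x : Fin n → ℝ) : ℂ :=
  ∑ a ∈ J, c a * modulate h (g a) (η a) x

lemma norm_scFT_packetSum_le {n : ℕ} {α : Type*} (h : ℝ) {J : Finset α} {c : α → ℂ}
    (hc : ∀ a ∈ J, ‖c a‖ ≤ 1) {g : α → (Fin n → ℝ) → ℂ} (hg : ∀ a, Continuous (g a))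
    (hgc : ∀ a, HasCompactSupport (g a)) (η : α → Fin n → ℝ) (ξ : Fin n → ℝ) :
    ‖scFT h (packetSum h J c g η) ξ‖ ≤ ∑ a ∈ J, ‖scFT h (g a) (ξ - η a)‖ := by
  have hcm : ∀ a, Continuous (modulate h (g a) (η a)) := fun a => by
    have := (contDiff_dotp_left (η a)).continuous
    unfold modulate
    fun_prop
  have : scFT h (packetSum h J c g η) ξ = ∑ a ∈ J, c a * scFT h (g a) (ξ - η a) := by
    simp_rw [← scFT_modulate]
    unfold scFT packetSum
    simp_rw [Finset.mul_sum, ← integral_const_mul]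
    rw [integral_finsetSum]
    · refine Finset.sum_congr rfl fun a _ =>
        integral_congr_ae (Filter.Eventually.of_forall fun x => ?_)
      ring
    · intro a _
      refine Continuous.integrable_of_hasCompactSupport ?_ ?_
      · have hd : Continuous fun x : Fin n → ℝ => dotp x ξ := (contDiff_dotp_left ξ).continuous
        have := hcm a
        fun_prop
      · exact (((hgc a).modulate h (η a)).mul_left).mul_left
  rw [this]
  refine (norm_sum_le _ _).trans (Finset.sum_le_sum fun a ha => ?_)
  rw [norm_mul]
  exact mul_le_of_le_one_left (norm_nonneg _) (hc a ha)

lemma norm_scFT_packetSum_le_of_separated {n : ℕ} {ι α : Type*} {S : Set ι} (hS : S.Finite)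
    {g : ι → (Fin n → ℝ) → ℂ} (hg : ∀ k, ContDiff ℝ (⊤ : ℕ∞) (g k))
    (hgc : ∀ k, HasCompactSupport (g k)) (κ : α → ι) (M : ℝ) (N : ℕ) :
    ∃ C : ℝ, 0 ≤ C ∧ ∀ h : ℝ, 0 < h → ∀ (J : Finset α) (c : α → ℂ) (η : α → Fin n → ℝ),
      (∀ a ∈ J, κ a ∈ S) → h ^ n * (J.card : ℝ) ≤ M → (∀ a ∈ J, ‖c a‖ ≤ 1) →
      ∀ (ξ : Fin n → ℝ) (ρ : ℝ), 0 < ρ → (∀ a ∈ J, g (κ a) ≠ 0 → ρ ≤ ‖ξ - η a‖) →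
        ‖scFT h (packetSum h J c (fun a => g (κ a)) η) ξ‖ ≤ C * h ^ N / ρ ^ (N + n) := by
  obtain ⟨C, hC0, hC⟩ := pow_mul_norm_scFT_le_of_finite hS hg hgc (N + n)
  refine ⟨C * |M|, by positivity, fun h hh J c η hJS hM hc ξ ρ hρ hsep => ?_⟩
  refine (norm_scFT_packetSum_le h hc (fun a => (hg _).continuous) (fun a => hgc _) η ξ).trans ?_
  have hterm : ∀ a ∈ J, ‖scFT h (g (κ a)) (ξ - η a)‖ ≤ C * h ^ (N + n) / ρ ^ (N + n) := by
    intro a ha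
    by_cases h0 : g (κ a) = 0
    · simp only [h0, scFT, Pi.zero_apply, mul_zero, integral_zero, norm_zero]
      positivity
    · rw [le_div_iff₀ (by positivity), mul_comm]
      refine le_trans ?_ (hC _ (hJS a ha) h hh (ξ - η a))
      gcongr
      exact hsep a ha h0
  refine (Finset.sum_le_card_nsmul _ _ _ hterm).trans ?_
  rw [nsmul_eq_mul, ← mul_div_assoc]
  refine div_le_div_of_nonneg_right ?_ (by positivity)
  calc (J.card : ℝ) * (C * h ^ (N + n)) = C * (h ^ n * J.card) * h ^ N := by ring
    _ ≤ C * |M| * h ^ N := by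
      gcongr
      exact hM.trans (le_abs_self M)

lemma norm_scFT_packetSum_le_uniform {n : ℕ} {ι α : Type*} {S : Set ι} (hS : S.Finite)
    {g : ι → (Fin n → ℝ) → ℂ} (hg : ∀ k, ContDiff ℝ (⊤ : ℕ∞) (g k))
    (hgc : ∀ k, HasCompactSupport (g k)) (κ : α → ι) (M : ℝ) :
    ∃ C : ℝ, 0 ≤ C ∧ ∀ h : ℝ, 0 < h → ∀ (J : Finset α) (c : α → ℂ) (η : α → Fin n → ℝ),
      (∀ a ∈ J, κ a ∈ S) → h ^ n * (J.card : ℝ) ≤ M → (∀ a ∈ J, ‖c a‖ ≤ 1) →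
      ∀ ξ : Fin n → ℝ,
        h ^ n * ‖scFT h (packetSum h J c (fun a => g (κ a)) η) ξ‖ ≤ C := by
  obtain ⟨C, hC0, hC⟩ := pow_mul_norm_scFT_le_of_finite hS hg hgc 0
  refine ⟨C * |M|, by positivity, fun h hh J c η hJS hM hc ξ => ?_⟩
  have h1 : ‖scFT h (packetSum h J c (fun a => g (κ a)) η) ξ‖ ≤ J.card * C := by
    refine (norm_scFT_packetSum_le h hc (fun a => (hg _).continuous) (fun a => hgc _) η ξ).trans ?_
    rw [← nsmul_eq_mul]
    refine Finset.sum_le_card_nsmul _ _ _ fun a ha => ?_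
    simpa using hC _ (hJS a ha) h hh (ξ - η a)
  calc _ ≤ h ^ n * (J.card * C) := by gcongr
    _ = C * (h ^ n * J.card) := by ring
    _ ≤ C * |M| := by
      gcongr
      exact hM.trans (le_abs_self M)

lemma IsCompact.exists_mul_one_add_norm_le_norm_sub {E : Type*} [NormedAddCommGroup E]
    {B U : Set E} (hB : IsCompact B) (hU : IsOpen U) (hBU : B ⊆ U) :
    ∃ r : ℝ, 0 < r ∧ ∀ ξ ∉ U, ∀ η ∈ B, r * (1 + ‖ξ‖) ≤ ‖ξ - η‖ := by
  obtain ⟨δ, hδ, hδU⟩ := hB.exists_thickening_subset_open hU hBU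
  obtain ⟨R, hR0, hR⟩ := hB.isBounded.exists_pos_norm_le
  refine ⟨((1 + R) / δ + 1)⁻¹, by positivity, fun ξ hξ η hη => ?_⟩
  have h1 : δ ≤ ‖ξ - η‖ := by
    by_contra! hlt
    exact hξ (hδU (Metric.mem_thickening_iff.2 ⟨η, hη, by rwa [dist_eq_norm]⟩))
  have h2 : ‖ξ‖ ≤ ‖ξ - η‖ + R := by
    have := norm_add_le (ξ - η) η
    rw [sub_add_cancel] at this
    linarith [hR η hη]
  rw [inv_mul_le_iff₀ (by positivity), add_mul, one_mul, div_mul_eq_mul_div]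
  have h3 : 1 + R ≤ (1 + R) * ‖ξ - η‖ / δ := by
    rw [le_div_iff₀ hδ]
    gcongr
  linarith

lemma sqrt_sum_sq_le {n : ℕ} (ξ : Fin n → ℝ) :
    Real.sqrt (∑ j, ξ j ^ 2) ≤ n * ‖ξ‖ := by
  rw [Real.sqrt_le_left (by positivity)]
  calc ∑ j, ξ j ^ 2 ≤ ∑ _j : Fin n, ‖ξ‖ ^ 2 := by
        refine Finset.sum_le_sum fun j _ => ?_
        rw [← sq_abs]
        gcongr
        exact norm_le_pi_norm ξ j
    _ = n * ‖ξ‖ ^ 2 := by simp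
    _ ≤ (n * ‖ξ‖) ^ 2 := by
      rw [mul_pow]
      gcongr
      exact_mod_cast Nat.le_self_pow two_ne_zero n

lemma sq_norm_le_sum_sq {n : ℕ} (ξ : Fin n → ℝ) : ‖ξ‖ ^ 2 ≤ ∑ j, ξ j ^ 2 := by
  have hs : 0 ≤ ∑ j, ξ j ^ 2 := Finset.sum_nonneg fun _ _ => sq_nonneg _
  refine (Real.le_sqrt (norm_nonneg _) hs).1 ?_
  refine (pi_norm_le_iff_of_nonneg (Real.sqrt_nonneg _)).2 fun j => ?_
  exact Real.abs_le_sqrt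
    (Finset.single_le_sum (f := fun j => ξ j ^ 2) (fun _ _ => sq_nonneg _) (Finset.mem_univ j))

lemma exists_hSobSq_le {n : ℕ} :
    ∃ s A : ℝ, 0 ≤ A ∧ ∀ (h : ℝ) (f : (Fin n → ℝ) → ℂ) (D : ℝ), 0 < h →
      (∀ ξ, ‖scFT h f ξ‖ ≤ D) → hSobSq n h s f ≤ A * h ^ (-(n : ℤ)) * D ^ 2 := by
  set r : ℝ := (n : ℝ) + 1 with hr
  have hint : Integrable (fun ξ : Fin n → ℝ => (1 + ‖ξ‖ ^ 2) ^ (-r / 2)) volume :=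
    integrable_rpow_neg_one_add_norm_sq (by simp [hr])
  have hpi := Real.pi_pos
  refine ⟨-r / 2, (2 * Real.pi) ^ (-(n : ℤ)) * ∫ ξ : Fin n → ℝ, (1 + ‖ξ‖ ^ 2) ^ (-r / 2),
    by positivity, fun h f D hh hD => ?_⟩
  unfold hSobSq
  have hle : ∫ ξ : Fin n → ℝ, (1 + ∑ j, ξ j ^ 2) ^ (-r / 2) * ‖scFT h f ξ‖ ^ 2
      ≤ ∫ ξ : Fin n → ℝ, (1 + ‖ξ‖ ^ 2) ^ (-r / 2) * D ^ 2 := by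
    refine integral_mono_of_nonneg (Filter.Eventually.of_forall fun ξ => ?_) (hint.mul_const _)
      (Filter.Eventually.of_forall fun ξ => ?_)
    · have : 0 ≤ ∑ j, ξ j ^ 2 := Finset.sum_nonneg fun _ _ => sq_nonneg _
      simp only [Pi.zero_apply]
      positivity
    · refine mul_le_mul ?_ ?_ (by positivity) (by positivity)
      · refine Real.rpow_le_rpow_of_nonpos (by positivity) ?_ ?_
        · linarith [sq_norm_le_sum_sq ξ]
        · have : (0 : ℝ) ≤ n := n.cast_nonneg
          linarith
      · gcongr
        exact hD ξ
  rw [integral_mul_const] at hle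
  rw [mul_zpow]
  refine (mul_le_mul_of_nonneg_left hle (by positivity)).trans (le_of_eq ?_)
  ring

/-- Superpositions of wave packets `g k` with frequencies such that the packets live in the compact
phase space region `K` are semiclassically band limited. -/
lemma scBandLimited_packetSum {n : ℕ} {ι α : Type*} {S : Set ι} (hS : S.Finite)
    {g : ι → (Fin n → ℝ) → ℂ} (hg : ∀ k, ContDiff ℝ (⊤ : ℕ∞) (g k))
    (hgc : ∀ k, HasCompactSupport (g k)) {κ : α → ι} {M h₀ : ℝ}
    {K : Set ((Fin n → ℝ) × (Fin n → ℝ))} (hK : IsCompact K)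
    {J : ℝ → Finset α} {c : ℝ → α → ℂ} {η : ℝ → α → Fin n → ℝ}
    (hJS : ∀ h ∈ Set.Ioc 0 h₀, ∀ a ∈ J h, κ a ∈ S)
    (hM : ∀ h ∈ Set.Ioc 0 h₀, h ^ n * ((J h).card : ℝ) ≤ M)
    (hc : ∀ h ∈ Set.Ioc 0 h₀, ∀ a ∈ J h, ‖c h a‖ ≤ 1)
    (hsupp : ∀ h ∈ Set.Ioc 0 h₀, ∀ a ∈ J h, ∀ x, g (κ a) x ≠ 0 → (x, η h a) ∈ K) :
    SCBandLimited n h₀ (fun h => packetSum h (J h) (c h) (fun a => g (κ a)) (η h))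
      (Prod.snd '' K) := by
  refine ⟨hK.image continuous_snd, fun h hh => ?_, ?_, ?_, ?_⟩
  · have hsub : Function.support (packetSum h (J h) (c h) (fun a => g (κ a)) (η h))
        ⊆ Prod.fst '' K := by
      intro x hx
      obtain ⟨a, ha, hax⟩ := Finset.exists_ne_zero_of_sum_ne_zero hx
      exact ⟨_, hsupp h hh a ha x (left_ne_zero_of_mul (right_ne_zero_of_mul hax)), rfl⟩
    refine ⟨?_, HasCompactSupport.of_support_subset_isCompact (hK.image continuous_fst) hsub⟩
    exact ContDiff.sum fun a _ => contDiff_const.mul (contDiff_modulate h (hg _) _)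
  · refine ⟨Prod.fst '' K, hK.image continuous_fst, fun h hh x hx => ?_⟩
    obtain ⟨a, ha, hax⟩ := Finset.exists_ne_zero_of_sum_ne_zero hx
    exact ⟨_, hsupp h hh a ha x (left_ne_zero_of_mul (right_ne_zero_of_mul hax)), rfl⟩
  · obtain ⟨s, A, hA0, hA⟩ := exists_hSobSq_le (n := n)
    obtain ⟨D, hD0, hD⟩ := norm_scFT_packetSum_le_uniform hS hg hgc κ M
    refine ⟨s, (3 * n : ℕ), A * D ^ 2, fun h hh => ?_⟩
    have hh0 : 0 < h := hh.1
    refine (hA h _ (D / h ^ n) hh0 fun ξ => ?_).trans (le_of_eq ?_)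
    · rw [le_div_iff₀ (by positivity), mul_comm]
      exact hD h hh0 _ _ _ (hJS h hh) (hM h hh) (hc h hh) ξ
    · rw [Real.rpow_neg hh0.le, Real.rpow_natCast, zpow_neg, zpow_natCast, pow_mul']
      field_simp
  · intro U hU hBU N
    obtain ⟨r, hr0, hr⟩ := (hK.image continuous_snd).exists_mul_one_add_norm_le_norm_sub hU hBU
    obtain ⟨C, hC0, hC⟩ := norm_scFT_packetSum_le_of_separated hS hg hgc κ M N
    refine ⟨C * ((n : ℝ) + 1) ^ N / r ^ (N + n), fun h hh ξ hξ => ?_⟩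
    have hh0 : 0 < h := hh.1
    have h1 := hC h hh0 _ _ _ (hJS h hh) (hM h hh) (hc h hh) ξ (r * (1 + ‖ξ‖)) (by positivity)
      fun a ha hne => by
        obtain ⟨x, hx⟩ := Function.ne_iff.1 hne
        exact hr ξ hξ _ ⟨_, hsupp h hh a ha x hx, rfl⟩
    refine h1.trans ?_
    rw [Real.rpow_neg (by positivity), Real.rpow_natCast, mul_pow, div_mul_eq_mul_div,
      div_mul_eq_mul_div, ← div_div, div_right_comm]
    refine div_le_div_of_nonneg_right ?_ (by positivity)
    rw [← div_eq_mul_inv, div_le_div_iff₀ (by positivity) (by positivity)]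
    have h2 : 1 + Real.sqrt (∑ j, ξ j ^ 2) ≤ (n + 1) * (1 + ‖ξ‖) := by
      have := sqrt_sum_sq_le ξ
      have : (0 : ℝ) ≤ n := n.cast_nonneg
      nlinarith [norm_nonneg ξ]
    have h3 : (1 + ‖ξ‖) ^ N ≤ (1 + ‖ξ‖) ^ (N + n) :=
      pow_le_pow_right₀ (by linarith [norm_nonneg ξ]) (Nat.le_add_right _ _)
    calc C * h ^ N * (1 + Real.sqrt (∑ j, ξ j ^ 2)) ^ N
        ≤ C * h ^ N * ((n + 1) * (1 + ‖ξ‖)) ^ N := by gcongr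
      _ = C * (n + 1) ^ N * h ^ N * (1 + ‖ξ‖) ^ N := by
        rw [mul_pow]
        ring
      _ ≤ C * (n + 1) ^ N * h ^ N * (1 + ‖ξ‖) ^ (N + n) := by gcongr

/-- The wave front set of a superposition of wave packets living in the closed
phase space region `K` is contained in `K`. -/
lemma notInSCWF_packetSum {n : ℕ} {ι α : Type*} {S : Set ι} (hS : S.Finite)
    {g : ι → (Fin n → ℝ) → ℂ} (hg : ∀ k, ContDiff ℝ (⊤ : ℕ∞) (g k))
    {κ : α → ι} {M h₀ : ℝ}
    {K : Set ((Fin n → ℝ) × (Fin n → ℝ))} (hK : IsClosed K)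
    {J : ℝ → Finset α} {c : ℝ → α → ℂ} {η : ℝ → α → Fin n → ℝ}
    (hJS : ∀ h ∈ Set.Ioc 0 h₀, ∀ a ∈ J h, κ a ∈ S)
    (hM : ∀ h ∈ Set.Ioc 0 h₀, h ^ n * ((J h).card : ℝ) ≤ M)
    (hc : ∀ h ∈ Set.Ioc 0 h₀, ∀ a ∈ J h, ‖c h a‖ ≤ 1)
    (hsupp : ∀ h ∈ Set.Ioc 0 h₀, ∀ a ∈ J h, ∀ x, g (κ a) x ≠ 0 → (x, η h a) ∈ K)
    {x₀ ξ₀ : Fin n → ℝ} (hx₀ : (x₀, ξ₀) ∉ K) :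
    NotInSCWF n h₀ (fun h => packetSum h (J h) (c h) (fun a => g (κ a)) (η h)) x₀ ξ₀ := by
  obtain ⟨ρ, hρ, hball⟩ := Metric.isOpen_iff.1 hK.isOpen_compl (x₀, ξ₀) hx₀
  let χ : ContDiffBump x₀ := ⟨ρ / 2, ρ, by positivity, by linarith⟩
  have hχ : ContDiff ℝ (⊤ : ℕ∞) (fun x => ((χ x : ℝ) : ℂ)) :=
    Complex.ofRealCLM.contDiff.comp χ.contDiff
  have hχc : HasCompactSupport (fun x => ((χ x : ℝ) : ℂ)) :=
    χ.hasCompactSupport.comp_left Complex.ofReal_zero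
  refine ⟨fun x => ((χ x : ℝ) : ℂ), hχ, hχc, ?_, Metric.ball ξ₀ (ρ / 2),
    Metric.ball_mem_nhds _ (by positivity), fun N => ?_⟩
  · simp [χ.one_of_mem_closedBall (Metric.mem_closedBall_self χ.rIn_pos.le)]
  obtain ⟨C, hC0, hC⟩ := norm_scFT_packetSum_le_of_separated hS
    (g := fun k x => ((χ x : ℝ) : ℂ) * g k x) (fun k => hχ.mul (hg k))
    (fun k => hχc.mul_right) κ M N
  refine ⟨C / (ρ / 2) ^ (N + n), fun h hh ξ hξ => ?_⟩
  have hfun : (fun x => ((χ x : ℝ) : ℂ) * packetSum h (J h) (c h) (fun a => g (κ a)) (η h) x)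
      = packetSum h (J h) (c h) (fun a x => ((χ x : ℝ) : ℂ) * g (κ a) x) (η h) := by
    funext x
    simp only [packetSum, modulate, Finset.mul_sum]
    exact Finset.sum_congr rfl fun a _ => by ring
  simp only [hfun]
  refine (hC h hh.1 _ _ _ (hJS h hh) (hM h hh) (hc h hh) ξ (ρ / 2) (by positivity)
    fun a ha hne => ?_).trans (le_of_eq (by ring))
  obtain ⟨x, hx⟩ := Function.ne_iff.1 hne
  have hx1 : x ∈ Metric.ball x₀ ρ := by
    have : x ∈ Function.support χ := fun h0 => hx (by simp [h0])
    rwa [χ.support_eq] at this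
  have hx2 := hsupp h hh a ha x (right_ne_zero_of_mul hx)
  by_contra! hlt
  refine hball ?_ hx2
  rw [← ball_prod_same]
  refine ⟨hx1, ?_⟩
  rw [Metric.mem_ball, dist_comm]
  calc dist ξ₀ (η h a) ≤ dist ξ₀ ξ + dist ξ (η h a) := dist_triangle _ _ _
    _ < ρ / 2 + ρ / 2 := by
      rw [dist_comm ξ₀, dist_eq_norm ξ (η h a)]
      exact add_lt_add hξ hlt
    _ = ρ := by ring

lemma setIntegral_Icc_exp_int {R : ℝ} (hR : 0 < R) (p : ℝ) (m : ℤ) :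
    ∫ x in Set.Icc (p - R) (p + R),
      Complex.exp (((x * (Real.pi / R * m) : ℝ) : ℂ) * Complex.I) =
      if m = 0 then ((2 * R : ℝ) : ℂ) else 0 := by
  rw [integral_Icc_eq_integral_Ioc, ← intervalIntegral.integral_of_le (by linarith)]
  split_ifs with hm
  · subst hm
    simp only [Int.cast_zero, mul_zero, Complex.ofReal_zero, zero_mul, Complex.exp_zero,
      intervalIntegral.integral_const]
    rw [Complex.real_smul, mul_one]
    congr 1
    ring
  · have hpi := Real.pi_ne_zero
    have hR' : (R : ℂ) ≠ 0 := by exact_mod_cast hR.ne'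
    have hpi' : (Real.pi : ℂ) ≠ 0 := by exact_mod_cast hpi
    have hm' : (m : ℂ) ≠ 0 := by exact_mod_cast hm
    set w : ℂ := (Real.pi : ℂ) / R * m * Complex.I with hw
    have hw0 : w ≠ 0 := by
      rw [hw]
      exact mul_ne_zero (mul_ne_zero (div_ne_zero hpi' hR') hm') Complex.I_ne_zero
    have heq : ∀ x : ℝ, Complex.exp (((x * (Real.pi / R * m) : ℝ) : ℂ) * Complex.I)
        = Complex.exp (w * x) := by
      intro x
      rw [hw]
      push_cast
      ring_nf
    simp_rw [heq]
    rw [integral_exp_mul_complex hw0, div_eq_zero_iff, sub_eq_zero]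
    left
    rw [Complex.exp_eq_exp_iff_exists_int]
    refine ⟨m, ?_⟩
    rw [hw]
    push_cast
    field_simp
    ring

lemma setIntegral_closedBall_exp_int {n : ℕ} {R : ℝ} (hR : 0 < R) (p : Fin n → ℝ)
    (m : Fin n → ℤ) :
    ∫ x in Metric.closedBall p R,
      Complex.exp (((∑ i, x i * (Real.pi / R * m i) : ℝ) : ℂ) * Complex.I) =
      if m = 0 then (((2 * R) ^ n : ℝ) : ℂ) else 0 := by
  have hexp : ∀ x : Fin n → ℝ,
      Complex.exp (((∑ i, x i * (Real.pi / R * m i) : ℝ) : ℂ) * Complex.I) =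
      ∏ i, Complex.exp (((x i * (Real.pi / R * m i) : ℝ) : ℂ) * Complex.I) := by
    intro x
    rw [← Complex.exp_sum, ← Finset.sum_mul, Complex.ofReal_sum]
  simp_rw [hexp]
  rw [closedBall_pi _ hR.le, volume_pi, Measure.restrict_pi_pi,
    integral_fintype_prod_eq_prod
      (f := fun i (y : ℝ) => Complex.exp (((y * (Real.pi / R * m i) : ℝ) : ℂ) * Complex.I))]
  simp_rw [Real.closedBall_eq_Icc, setIntegral_Icc_exp_int hR]
  split_ifs with hm
  · subst hm
    simp
  · obtain ⟨i, hi⟩ := Function.ne_iff.1 hm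
    exact Finset.prod_eq_zero (Finset.mem_univ i) (if_neg hi)

/-- Wave packets with frequencies in a lattice dual to the cubes on which their envelopes are one
have square-integral bounded below by the size of any coefficient. -/
lemma pow_le_integral_norm_packetSum_sq {n : ℕ} {h R : ℝ} (hh : 0 < h) (hR : 0 < R)
    {g : (Fin n → ℤ) → (Fin n → ℝ) → ℂ} (hg : ∀ k, Continuous (g k))
    (hgc : ∀ k, HasCompactSupport (g k)) {p : (Fin n → ℤ) → Fin n → ℝ}
    (hg1 : ∀ k, ∀ x ∈ Metric.closedBall (p k) R, g k x = 1)
    (hg0 : ∀ k l, l ≠ k → ∀ x ∈ Metric.closedBall (p k) R, g l x = 0)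
    (J : Finset ((Fin n → ℤ) × (Fin n → ℤ))) (c : (Fin n → ℤ) × (Fin n → ℤ) → ℂ)
    {a₀ : (Fin n → ℤ) × (Fin n → ℤ)} (ha₀ : a₀ ∈ J) (hc : ‖c a₀‖ = 1) :
    (2 * R) ^ n ≤ ∫ x, ‖packetSum h J c (fun a => g a.1)
      (fun a i => Real.pi * h / R * a.2 i) x‖ ^ 2 := by
  set F := packetSum h J c (fun a => g a.1) (fun a i => Real.pi * h / R * a.2 i) with hF
  have hdot : ∀ η : Fin n → ℝ, Continuous fun x : Fin n → ℝ => dotp x η :=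
    fun η => (contDiff_dotp_left η).continuous
  have hFc : Continuous F := by
    refine continuous_finsetSum _ fun a _ => continuous_const.mul ?_
    have := hdot fun i => Real.pi * h / R * a.2 i
    have := hg a.1
    unfold modulate
    fun_prop
  have hFs : HasCompactSupport F := by
    refine HasCompactSupport.of_support_subset_isCompact
      (J.isCompact_biUnion fun a _ => hgc a.1) fun x hx => ?_
    obtain ⟨a, ha, hax⟩ := Finset.exists_ne_zero_of_sum_ne_zero hx
    exact Set.mem_biUnion ha
      (subset_tsupport _ (left_ne_zero_of_mul (right_ne_zero_of_mul hax)))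
  set B := Metric.closedBall (p a₀.1) R with hB
  have hBc : IsCompact B := isCompact_closedBall _ _
  set e : (Fin n → ℝ) → ℂ := fun x =>
    Complex.exp (((-(dotp x fun i => Real.pi * h / R * a₀.2 i) / h : ℝ) : ℂ) * Complex.I) with he
  have hnorm : ∀ x, ‖e x‖ = 1 := fun x => Complex.norm_exp_ofReal_mul_I _
  have hpt : ∀ x ∈ B, e x * F x = ∑ a ∈ J, if a.1 = a₀.1 then c a *
      Complex.exp (((∑ i, x i * (Real.pi / R * (a.2 - a₀.2) i) : ℝ) : ℂ) * Complex.I)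
      else 0 := by
    intro x hx
    rw [hF, packetSum, Finset.mul_sum]
    refine Finset.sum_congr rfl fun a _ => ?_
    split_ifs with ha
    · rw [modulate, ha, hg1 _ x hx, one_mul, mul_left_comm, he, ← Complex.exp_add, ← add_mul,
        ← Complex.ofReal_add]
      congr 4
      simp only [dotp, neg_div, Finset.sum_div, ← Finset.sum_neg_distrib,
        ← Finset.sum_add_distrib]
      refine Finset.sum_congr rfl fun i _ => ?_
      simp only [Pi.sub_apply, Int.cast_sub]
      field_simp
      ring
    · rw [modulate, hg0 _ _ ha x hx]
      ring
  have hint : ∫ x in B, e x * F x = c a₀ * (((2 * R) ^ n : ℝ) : ℂ) := by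
    rw [setIntegral_congr_fun hBc.measurableSet hpt, integral_finsetSum]
    · rw [Finset.sum_eq_single a₀]
      · simp only [if_true]
        rw [integral_const_mul, setIntegral_closedBall_exp_int hR, if_pos (sub_self _)]
      · intro a _ hne
        split_ifs with ha
        · rw [integral_const_mul, setIntegral_closedBall_exp_int hR, if_neg, mul_zero]
          exact fun h0 => hne (Prod.ext ha (sub_eq_zero.1 h0))
        · simp
      · exact fun h0 => absurd ha₀ h0
    · intro a _
      split_ifs
      · exact ContinuousOn.integrableOn_compact hBc (by fun_prop)
      · exact integrable_zero _ _ _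
  have hvol : volume.real B = (2 * R) ^ n := by
    rw [hB, Measure.real, Real.volume_pi_closedBall _ hR.le, Fintype.card_fin,
      ENNReal.toReal_ofReal (by positivity)]
  have hI : IntegrableOn (fun x => ‖F x‖ ^ 2) B :=
    ContinuousOn.integrableOn_compact hBc (by fun_prop)
  have hconst : IntegrableOn (fun _ : Fin n → ℝ => (1 : ℝ)) B :=
    ContinuousOn.integrableOn_compact hBc (by fun_prop)
  have h1 : (2 * R) ^ n ≤ ∫ x in B, ‖F x‖ := by
    calc (2 * R) ^ n = ‖∫ x in B, e x * F x‖ := by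
          rw [hint, norm_mul, hc, one_mul, Complex.norm_real, Real.norm_of_nonneg (by positivity)]
      _ ≤ ∫ x in B, ‖e x * F x‖ := norm_integral_le_integral_norm _
      _ = ∫ x in B, ‖F x‖ := by simp_rw [norm_mul, hnorm, one_mul]
  have h2 : ∫ x in B, ‖F x‖ ≤ ∫ x in B, (2⁻¹ * ‖F x‖ ^ 2 + 2⁻¹ * 1) := by
    refine setIntegral_mono (ContinuousOn.integrableOn_compact hBc (by fun_prop))
      ((hI.const_mul _).add (hconst.const_mul _)) fun x => ?_
    nlinarith [sq_nonneg (‖F x‖ - 1)]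
  rw [integral_add (hI.const_mul _) (hconst.const_mul _), integral_const_mul, integral_const_mul,
    setIntegral_const, hvol, smul_eq_mul] at h2
  have h3 : ∫ x in B, ‖F x‖ ^ 2 ≤ ∫ x, ‖F x‖ ^ 2 := by
    refine setIntegral_le_integral ?_ (Filter.Eventually.of_forall fun x => by positivity)
    refine Continuous.integrable_of_hasCompactSupport (by fun_prop) ?_
    exact hFs.comp_left (g := fun z : ℂ => ‖z‖ ^ 2) (by simp)
  linarith

/-- A homogeneous linear system with more unknowns than equations has a solution with coefficients
of modulus at most one, one of which has modulus one. -/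
lemma exists_normalized_solution {α β : Type*} (J : Finset α) (X : Finset β)
    (hcard : X.card < J.card) (v : α → β → ℂ) :
    ∃ c : α → ℂ, (∀ a ∈ J, ‖c a‖ ≤ 1) ∧ (∃ a ∈ J, ‖c a‖ = 1) ∧
      ∀ x ∈ X, ∑ a ∈ J, c a * v a x = 0 := by
  classical
  let T : (J → ℂ) →ₗ[ℂ] (X → ℂ) :=
    Matrix.mulVecLin (Matrix.of fun (x : X) (a : J) => v a x)
  have hT : T.ker ≠ ⊥ := LinearMap.ker_ne_bot_of_finrank_lt (by simpa using hcard)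
  obtain ⟨u, hu, hu0⟩ := (Submodule.ne_bot_iff _).1 hT
  have hsol : ∀ x ∈ X, ∑ a : J, u a * v a x = 0 := by
    intro x hx
    have := congrFun (LinearMap.mem_ker.1 hu) ⟨x, hx⟩
    simpa [T, Matrix.mulVec, dotProduct, mul_comm] using this
  have hne : (Finset.univ : Finset J).Nonempty := by
    obtain ⟨a, -⟩ := Function.ne_iff.1 hu0
    exact ⟨a, Finset.mem_univ a⟩
  obtain ⟨a₀, -, hmax⟩ := Finset.exists_max_image Finset.univ (fun a : J => ‖u a‖) hne
  have hpos : 0 < ‖u a₀‖ := by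
    obtain ⟨a, ha⟩ := Function.ne_iff.1 hu0
    exact (norm_pos_iff.2 ha).trans_le (hmax a (Finset.mem_univ a))
  refine ⟨fun a => if ha : a ∈ J then u ⟨a, ha⟩ / ‖u a₀‖ else 0, fun a ha => ?_,
    ⟨a₀, a₀.2, ?_⟩, fun x hx => ?_⟩
  · simp only [ha, dif_pos, norm_div, Complex.norm_real, norm_norm]
    exact (div_le_one hpos).2 (hmax ⟨a, ha⟩ (Finset.mem_univ _))
  · simp [hpos.ne']
  · rw [← Finset.sum_coe_sort]
    simp only [Finset.coe_mem, dif_pos, div_mul_eq_mul_div, Subtype.coe_eta]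
    rw [← Finset.sum_div, hsol x hx, zero_div]

lemma exists_lt_measure_closedBall_subset {E : Type*} [PseudoMetricSpace E] [MeasurableSpace E]
    (μ : Measure E) (K : Set E) {v : ENNReal} (hv : v < μ (interior K)) :
    ∃ r : ℝ, 0 < r ∧ v < μ {p | Metric.closedBall p r ⊆ K} := by
  set A : ℕ → Set E := fun m => {p | Metric.closedBall p (1 / ((m : ℝ) + 1)) ⊆ K}
  have hmono : Monotone A := fun m l hml p hp =>
    (Metric.closedBall_subset_closedBall (one_div_le_one_div_of_le (by positivity)
      (by exact_mod_cast Nat.succ_le_succ hml))).trans hp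
  have hsub : interior K ⊆ ⋃ m, A m := by
    intro p hp
    obtain ⟨ρ, hρ, hball⟩ := Metric.isOpen_iff.1 isOpen_interior p hp
    obtain ⟨m, hm⟩ := exists_nat_one_div_lt hρ
    exact Set.mem_iUnion.2 ⟨m, (Metric.closedBall_subset_ball hm).trans
      (hball.trans interior_subset)⟩
  have h1 := hv.trans_le (measure_mono hsub)
  rw [hmono.measure_iUnion, lt_iSup_iff] at h1
  obtain ⟨m, hm⟩ := h1
  exact ⟨1 / ((m : ℝ) + 1), by positivity, hm⟩

/-- The centre of the grid cube of side `r` with index `k`. -/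
noncomputable def gridCenter {n : ℕ} (r : ℝ) (k : Fin n → ℤ) (i : Fin n) : ℝ :=
  r * k i + r / 2

/-- The indices of the grid cells (of side `r` in position, `t` in frequency) whose position cube
times frequency corner lies in `K`. -/
def cellsIn {n : ℕ} (K : Set ((Fin n → ℝ) × (Fin n → ℝ))) (r t : ℝ) :
    Set ((Fin n → ℤ) × (Fin n → ℤ)) :=
  {a | ∀ x ∈ Metric.closedBall (gridCenter r a.1) (r / 2), (x, fun i => t * (a.2 i : ℝ)) ∈ K}

lemma volume_closedBall_subset_le {n : ℕ} (K : Set ((Fin n → ℝ) × (Fin n → ℝ))) {r t : ℝ}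
    (hr : 0 < r) (ht : 0 < t) (htr : t ≤ r) (T : Finset ((Fin n → ℤ) × (Fin n → ℤ)))
    (hT : cellsIn K r t ⊆ T) :
    volume {p | Metric.closedBall p r ⊆ K} ≤ T.card * ENNReal.ofReal (r ^ n * t ^ n) := by
  have hcover : {p | Metric.closedBall p r ⊆ K} ⊆ ⋃ a ∈ T,
      (Set.univ.pi fun i => Set.Ico (r * (a.1 i : ℝ)) (r * a.1 i + r)) ×ˢ
      (Set.univ.pi fun i => Set.Ico (t * (a.2 i : ℝ)) (t * a.2 i + t)) := by
    rintro ⟨x, ξ⟩ hp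
    have hfl : ∀ {s : ℝ}, 0 < s → ∀ y : ℝ, s * (⌊y / s⌋ : ℝ) ≤ y ∧ y < s * ⌊y / s⌋ + s := by
      intro s hs y
      constructor
      · have := Int.floor_le (y / s)
        rwa [le_div_iff₀ hs, mul_comm] at this
      · have := Int.lt_floor_add_one (y / s)
        rw [div_lt_iff₀ hs] at this
        linarith
    refine Set.mem_biUnion (x := (fun i => ⌊x i / r⌋, fun i => ⌊ξ i / t⌋)) (hT ?_)
      ⟨fun i _ => hfl hr (x i), fun i _ => hfl ht (ξ i)⟩
    intro y hy
    refine hp ?_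
    rw [← closedBall_prod_same]
    refine ⟨?_, ?_⟩
    · refine (dist_pi_le_iff hr.le).2 fun i => ?_
      have h1 := (dist_pi_le_iff (by positivity)).1 (Metric.mem_closedBall.1 hy) i
      obtain ⟨h2, h3⟩ := hfl hr (x i)
      rw [Real.dist_eq, gridCenter, abs_le] at h1
      rw [Real.dist_eq, abs_le]
      constructor <;> linarith [h1.1, h1.2]
    · refine (dist_pi_le_iff hr.le).2 fun i => ?_
      obtain ⟨h2, h3⟩ := hfl ht (ξ i)
      rw [Real.dist_eq, abs_le]
      constructor <;> simp only <;> linarith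
  refine (measure_mono hcover).trans ((measure_biUnion_finset_le _ _).trans ?_)
  refine (Finset.sum_le_card_nsmul _ _ (ENNReal.ofReal (r ^ n * t ^ n)) fun a _ => ?_).trans
    (by rw [nsmul_eq_mul])
  rw [Measure.volume_eq_prod, Measure.prod_prod, Real.volume_pi_Ico, Real.volume_pi_Ico,
    ENNReal.ofReal_mul (by positivity)]
  simp [ENNReal.ofReal_pow hr.le, ENNReal.ofReal_pow ht.le]

lemma exists_finset_subset_cellsIn {n : ℕ} (K : Set ((Fin n → ℝ) × (Fin n → ℝ))) {r t : ℝ}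
    (hr : 0 < r) (ht : 0 < t) (htr : t ≤ r) {N : ℕ}
    (hN : N * ENNReal.ofReal (r ^ n * t ^ n) < volume {p | Metric.closedBall p r ⊆ K}) :
    ∃ J : Finset ((Fin n → ℤ) × (Fin n → ℤ)), ↑J ⊆ cellsIn K r t ∧ J.card = N + 1 := by
  by_cases hfin : (cellsIn K r t).Finite
  · have h1 := hN.trans_le (volume_closedBall_subset_le K hr ht htr hfin.toFinset (by simp))
    have h2 : N + 1 ≤ hfin.toFinset.card := by
      by_contra! hlt
      refine absurd h1 (not_lt.2 ?_)
      gcongr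
      lia
    obtain ⟨J, hJ, hcard⟩ := Finset.exists_subset_card_eq h2
    exact ⟨J, fun a ha => hfin.mem_toFinset.1 (hJ ha), hcard⟩
  · exact Set.Infinite.exists_subset_card_eq hfin _

lemma finite_gridCenter_mem {n : ℕ} {r : ℝ} (hr : 0 < r) {B : Set (Fin n → ℝ)}
    (hB : Bornology.IsBounded B) : {k : Fin n → ℤ | gridCenter r k ∈ B}.Finite := by
  obtain ⟨D, hD0, hD⟩ := hB.exists_pos_norm_le
  set m : ℤ := ⌈D / r + 1⌉
  refine (Set.finite_Icc (fun _ : Fin n => -m) (fun _ => m)).subset fun k hk => ?_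
  have h1 : ∀ i, |r * k i + r / 2| ≤ D := fun i =>
    (norm_le_pi_norm (gridCenter r k) i).trans (hD _ hk)
  have h2 : D + r ≤ r * m := by
    have : D / r + 1 ≤ m := Int.le_ceil _
    rw [div_add_one hr.ne', div_le_iff₀ hr] at this
    linarith
  constructor <;> intro i
  · have h3 := (abs_le.1 (h1 i)).1
    have : r * (-(m : ℝ)) ≤ r * k i := by linarith
    exact_mod_cast le_of_mul_le_mul_left this hr
  · have h3 := (abs_le.1 (h1 i)).2
    have : r * (k i : ℝ) ≤ r * m := by linarith
    exact_mod_cast le_of_mul_le_mul_left this hr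

lemma half_le_dist_gridCenter {n : ℕ} {r R : ℝ} (hr : 0 < r) (hRr : R ≤ r / 2)
    {k l : Fin n → ℤ} (hkl : l ≠ k) {x : Fin n → ℝ}
    (hx : x ∈ Metric.closedBall (gridCenter r k) R) : r / 2 ≤ dist x (gridCenter r l) := by
  obtain ⟨i, hi⟩ := Function.ne_iff.1 hkl
  have h1 : dist (gridCenter r k i) (gridCenter r l i) ≤ R + dist x (gridCenter r l) := by
    refine (dist_triangle_left _ _ (x i)).trans ?_
    exact add_le_add ((dist_le_pi_dist _ _ i).trans hx) (dist_le_pi_dist _ _ i)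
  have h2 : r ≤ dist (gridCenter r k i) (gridCenter r l i) := by
    have h3 : (1 : ℝ) ≤ |((k i - l i : ℤ) : ℝ)| := by
      exact_mod_cast Int.one_le_abs (sub_ne_zero.2 (Ne.symm hi))
    rw [Real.dist_eq, gridCenter, gridCenter, add_sub_add_right_eq_sub, ← mul_sub, abs_mul,
      abs_of_pos hr]
    push_cast at h3
    nlinarith
  linarith

/-- semiclassical Landau-type lower bound on the number of sampling points.
If every semiclassically band limited family with `WF_h(f) ⊂ K` satisfies the stability
estimate `‖f_h‖² ≤ C Σ_{x∈X(h)} |f_h(x)|² + O(h^∞)`, then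
`N(h) = #X(h) ≥ (2πh)^{−n} Vol(K°)(1−o(1))` as `h → 0`. -/
theorem stmt11 (n : ℕ) (h₀ : ℝ) (hh₀ : 0 < h₀)
    (K : Set ((Fin n → ℝ) × (Fin n → ℝ))) (hK : IsCompact K)
    (X : ℝ → Finset (Fin n → ℝ)) (C : ℝ)
    (hstab : ∀ f : ℝ → (Fin n → ℝ) → ℂ,
      (∃ 𝓑 : Set (Fin n → ℝ), SCBandLimited n h₀ f 𝓑) →
      (∀ x₀ ξ₀ : Fin n → ℝ, (x₀, ξ₀) ∉ K → NotInSCWF n h₀ f x₀ ξ₀) →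
      ∀ N : ℕ, ∃ C' : ℝ, ∀ h ∈ Set.Ioc (0 : ℝ) h₀,
        (∫ x : Fin n → ℝ, ‖f h x‖ ^ 2) ≤
          C * (∑ x ∈ X h, ‖f h x‖ ^ 2) + C' * h ^ N) :
    ∀ ε : ℝ, 0 < ε → ∃ δ : ℝ, 0 < δ ∧ ∀ h : ℝ, 0 < h → h < δ → h ≤ h₀ →
      ((volume (interior K)).toReal - ε) ≤ (2 * Real.pi * h) ^ n * ((X h).card : ℝ) := by
  intro ε hε
  by_contra! hbad
  have hpi := Real.pi_pos
  set V := (volume (interior K)).toReal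
  have hVε : 0 < V - ε := by
    obtain ⟨h, h0, -, -, hlt⟩ := hbad 1 one_pos
    exact lt_of_le_of_lt (by positivity) hlt
  have hVfin : volume (interior K) ≠ ⊤ :=
    ((measure_mono interior_subset).trans_lt hK.measure_lt_top).ne
  obtain ⟨r, hr, hrV⟩ := exists_lt_measure_closedBall_subset volume K
    (v := ENNReal.ofReal (V - ε / 2)) (by
      rw [← ENNReal.ofReal_toReal hVfin]
      exact (ENNReal.ofReal_lt_ofReal_iff (by linarith)).2 (by linarith))
  obtain ⟨θ, hθ, hθ0, hθ1⟩ : ∃ θ : ℝ, V - ε < θ ^ n * (V - ε / 2) ∧ 0 < θ ∧ θ < 1 := by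
    have hcont : Filter.Tendsto (fun θ : ℝ => θ ^ n * (V - ε / 2)) (nhdsWithin 1 (Set.Iio 1))
        (nhds (1 ^ n * (V - ε / 2))) :=
      (Continuous.tendsto (by fun_prop) 1).mono_left nhdsWithin_le_nhds
    have h1 := hcont.eventually_const_lt (u := V - ε) (by rw [one_pow]; linarith)
    have h2 : ∀ᶠ θ : ℝ in nhdsWithin 1 (Set.Iio 1), 0 < θ ∧ θ < 1 :=
      Ioo_mem_nhdsLT one_pos
    exact (h1.and h2).exists
  set R := θ * r / 2 with hR
  have hR0 : 0 < R := by positivity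
  have hRr : R < r / 2 := by
    rw [hR]
    nlinarith
  let b : ∀ k : Fin n → ℤ, ContDiffBump (gridCenter r k) := fun k => ⟨R, r / 2, hR0, hRr⟩
  set g : (Fin n → ℤ) → (Fin n → ℝ) → ℂ := fun k x => ((b k x : ℝ) : ℂ) with hgdef
  have hg : ∀ k, ContDiff ℝ (⊤ : ℕ∞) (g k) := fun k =>
    Complex.ofRealCLM.contDiff.comp (b k).contDiff
  have hgc : ∀ k, HasCompactSupport (g k) := fun k =>
    (b k).hasCompactSupport.comp_left Complex.ofReal_zero
  have hg1 : ∀ k, ∀ x ∈ Metric.closedBall (gridCenter r k) R, g k x = 1 := fun k x hx => by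
    simp [hgdef, (b k).one_of_mem_closedBall hx]
  have hg0 : ∀ k l, l ≠ k → ∀ x ∈ Metric.closedBall (gridCenter r k) R, g l x = 0 :=
    fun k l hkl x hx => by
      simp [hgdef, (b l).zero_of_le_dist (half_le_dist_gridCenter hr hRr.le hkl hx)]
  have hgs : ∀ k x, g k x ≠ 0 → x ∈ Metric.closedBall (gridCenter r k) (r / 2) := by
    intro k x hx
    refine Metric.ball_subset_closedBall ?_
    change x ∈ Metric.ball _ (b k).rOut
    rw [← (b k).support_eq]
    exact fun h0 => hx (by simp [hgdef, h0])
  set S := {k : Fin n → ℤ | gridCenter r k ∈ Prod.fst '' K}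
  have hSfin : S.Finite := finite_gridCenter_mem hr (hK.image continuous_fst).isBounded
  set Bad : ℝ → Prop := fun h => 0 < h ∧ h ≤ h₀ ∧ h < r * R / Real.pi ∧
    (2 * Real.pi * h) ^ n * ((X h).card : ℝ) < V - ε
  set η : ℝ → (Fin n → ℤ) × (Fin n → ℤ) → Fin n → ℝ :=
    fun h a i => Real.pi * h / R * a.2 i
  have hdata : ∀ h, ∃ (J : Finset ((Fin n → ℤ) × (Fin n → ℤ)))
      (c : (Fin n → ℤ) × (Fin n → ℤ) → ℂ),
      (∀ a ∈ J, ∀ x, g a.1 x ≠ 0 → (x, η h a) ∈ K) ∧ (∀ a ∈ J, a.1 ∈ S) ∧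
      (h ^ n * (J.card : ℝ) ≤ V + h₀ ^ n) ∧ (∀ a ∈ J, ‖c a‖ ≤ 1) ∧
      (Bad h → (∃ a ∈ J, ‖c a‖ = 1) ∧
        ∀ x ∈ X h, packetSum h J c (fun a => g a.1) (η h) x = 0) := by
    intro h
    by_cases hb : Bad h
    swap
    · refine ⟨∅, 0, by simp, by simp, ?_, by simp, fun h1 => absurd h1 hb⟩
      have : 0 ≤ V := ENNReal.toReal_nonneg
      simp only [Finset.card_empty, Nat.cast_zero, mul_zero]
      positivity
    obtain ⟨h0, hh, hδ, hlt⟩ := hb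
    have ht0 : 0 < Real.pi * h / R := by positivity
    have htr : Real.pi * h / R ≤ r := by
      rw [lt_div_iff₀ hpi] at hδ
      rw [div_le_iff₀ hR0]
      linarith
    obtain ⟨J, hJ, hcard⟩ := exists_finset_subset_cellsIn K hr ht0 htr (N := (X h).card) (by
      refine lt_of_le_of_lt ?_ hrV
      rw [← ENNReal.ofReal_natCast, ← ENNReal.ofReal_mul (by positivity)]
      refine ENNReal.ofReal_le_ofReal ?_
      have h1 : r ^ n * (Real.pi * h / R) ^ n = (2 * Real.pi * h) ^ n / θ ^ n := by
        rw [← mul_pow, ← div_pow, hR]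
        congr 1
        field_simp
      rw [h1, ← mul_div_assoc, div_le_iff₀ (by positivity)]
      linarith)
    obtain ⟨c, hc, hc1, hc0⟩ := exists_normalized_solution J (X h) (by lia)
      (fun a x => modulate h (g a.1) (η h a) x)
    refine ⟨J, c, fun a ha x hx => hJ ha x (hgs _ x hx), fun a ha => ?_, ?_, hc,
      fun _ => ⟨hc1, hc0⟩⟩
    · exact ⟨_, hJ ha _ (Metric.mem_closedBall_self (by positivity)), rfl⟩
    · rw [hcard]
      push_cast
      have h1 : h ^ n * ((X h).card : ℝ) ≤ (2 * Real.pi * h) ^ n * ((X h).card : ℝ) := by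
        gcongr
        nlinarith [Real.pi_gt_three]
      have h2 : h ^ n ≤ h₀ ^ n := by gcongr
      linarith
  choose J c hJK hJS hJM hc hJbad using hdata
  obtain ⟨C', hC'⟩ := hstab (fun h => packetSum h (J h) (c h) (fun a => g a.1) (η h))
    ⟨_, scBandLimited_packetSum hSfin hg hgc (κ := Prod.fst) hK (fun h _ => hJS h)
      (fun h _ => hJM h) (fun h _ => hc h) (fun h _ => hJK h)⟩
    (fun x₀ ξ₀ hx => notInSCWF_packetSum hSfin hg (κ := Prod.fst) hK.isClosed
      (fun h _ => hJS h) (fun h _ => hJM h) (fun h _ => hc h) (fun h _ => hJK h) hx) 1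
  have hlow : 0 < (2 * R) ^ n / (|C'| + 1) := by positivity
  obtain ⟨h, h0, hδ, hh, hlt⟩ := hbad (min (r * R / Real.pi) ((2 * R) ^ n / (|C'| + 1)))
    (lt_min (by positivity) hlow)
  obtain ⟨⟨a, ha, hca⟩, hzero⟩ := hJbad h ⟨h0, hh, hδ.trans_le (min_le_left _ _), hlt⟩
  have h1 := hC' h ⟨h0, hh⟩
  have h2 := pow_le_integral_norm_packetSum_sq h0 hR0 (fun k => (hg k).continuous) hgc hg1 hg0
    (J h) (c h) ha hca
  have h3 : ∑ x ∈ X h, ‖packetSum h (J h) (c h) (fun a => g a.1) (η h) x‖ ^ 2 = 0 :=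
    Finset.sum_eq_zero fun x hx => by rw [hzero x hx, norm_zero, zero_pow two_ne_zero]
  rw [h3, mul_zero, zero_add, pow_one] at h1
  have h4 := hδ.trans_le (min_le_right _ _)
  rw [lt_div_iff₀ (by positivity)] at h4
  have h5 : C' * h ≤ |C'| * h := by
    gcongr
    exact le_abs_self C'
  linarith
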